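/- Let (E, 𝓔) be a measurable space, let K be a nonnegative kernel on (E, 𝓔), let ρ ≥ 0, and let l be a nonzero σ-finite measure on (E, 𝓔) that is a left eigenmeasure of K with eigenvalue ρ, i.e., ∫_E K(x, A) l(dx) = ρ · l(A) for every A ∈ 𝓔. Let L be a nonnegative kernel on (E, 𝓔) such that ∫_E ∫_E L(y, E) K(x, dy) l(dx) < ∞, such that ℛL(x) := L(x, E) satisfies 0 < ℛL(x) < ∞ for all x ∈ E, and such that 0 < ∫_E ℛL(x) l(dx) < ∞. Then inf_{x ∈ E} ℛ(K·L)(x)/ℛL(x) ≤ ρ ≤ sup_{x ∈ E} ℛ(K·L)(x)/ℛL(x), where ℛ(K·L)(x) = ∫_E ℛL(y) K(x, dy). -/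

import Mathlib

open MeasureTheory ProbabilityTheory
open scoped ENNReal

/-- Integrating against a left eigenmeasure of a kernel multiplies integrals by the eigenvalue. -/
theorem lintegral_lintegral_of_left_eigenmeasure {E : Type*} [MeasurableSpace E] (K : Kernel E E)
    (ρ : ℝ≥0∞) (l : Measure E)
    (heig : ∀ A : Set E, MeasurableSet A → ∫⁻ x, K x A ∂l = ρ * l A)
    {f : E → ℝ≥0∞} (hf : Measurable f) :
    ∫⁻ x, ∫⁻ y, f y ∂(K x) ∂l = ρ * ∫⁻ x, f x ∂l := by
  have hbind : l.bind K = ρ • l := by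
    ext A hA
    rw [Measure.bind_apply hA K.aemeasurable, heig A hA, Measure.smul_apply, smul_eq_mul]
  rw [← Measure.lintegral_bind K.aemeasurable hf.aemeasurable, hbind, lintegral_smul_measure,
    smul_eq_mul]

/-- Main theorem of the paper. Let `K` be a nonnegative kernel on `(E, 𝓔)`,
`ρ ≥ 0` (a finite nonnegative eigenvalue), and `l` a nonzero σ-finite left eigenmeasure of `K`
with eigenvalue `ρ`, i.e. `∫ K(x,A) l(dx) = ρ·l(A)` for all measurable `A`.  If `L` is a
nonnegative kernel with `∫∫ L(y,E) K(x,dy) l(dx) < ∞`, `0 < ℛL(x) < ∞` for all `x`, and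
`0 < ∫ ℛL dl < ∞`, then
`inf_x ℛ(K·L)(x)/ℛL(x) ≤ ρ ≤ sup_x ℛ(K·L)(x)/ℛL(x)`,
where `ℛ(K·L)(x) = ∫ ℛL(y) K(x,dy)` and `ℛL(y) = L(y,E)`. -/
theorem perron_root_bounds {E : Type*} [MeasurableSpace E] (K L : Kernel E E)
    (ρ : ℝ≥0∞) (hρ : ρ ≠ ⊤) (l : Measure E) [SigmaFinite l] (hl : l ≠ 0)
    (heig : ∀ A : Set E, MeasurableSet A → ∫⁻ x, K x A ∂l = ρ * l A)
    (hKL : ∫⁻ x, ∫⁻ y, L y Set.univ ∂(K x) ∂l < ⊤)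
    (hL : ∀ x, 0 < L x Set.univ ∧ L x Set.univ < ⊤)
    (hLl : 0 < ∫⁻ x, L x Set.univ ∂l ∧ ∫⁻ x, L x Set.univ ∂l < ⊤) :
    (⨅ x, (∫⁻ y, L y Set.univ ∂(K x)) / L x Set.univ) ≤ ρ ∧
      ρ ≤ ⨆ x, (∫⁻ y, L y Set.univ ∂(K x)) / L x Set.univ := by
  have hf : Measurable fun x => L x Set.univ := L.measurable_coe MeasurableSet.univ
  have hρint := lintegral_lintegral_of_left_eigenmeasure K ρ l heig hf
  constructor
  · rw [← ENNReal.mul_le_mul_iff_left hLl.1.ne' hLl.2.ne, ← hρint, ← lintegral_const_mul _ hf]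
    exact lintegral_mono fun x =>
      (ENNReal.le_div_iff_mul_le (.inl (hL x).1.ne') (.inl (hL x).2.ne)).1 (iInf_le _ x)
  · rw [← ENNReal.mul_le_mul_iff_left hLl.1.ne' hLl.2.ne, ← hρint, ← lintegral_const_mul _ hf]
    exact lintegral_mono fun x =>
      (ENNReal.div_le_iff (hL x).1.ne' (hL x).2.ne).1
        (le_iSup (fun x => (∫⁻ y, L y Set.univ ∂(K x)) / L x Set.univ) x)
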